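/- arXiv:2310.19847 — 2 statements merged into one kernel-verified Lean document; each statement's English description precedes it below -/
import Mathlib

section
/- ∫₀^∞ tanh(z)²/z² dz = 14 ζ(3)/π². -/
open Real MeasureTheory

open Filter Topology

theorem hasSum_one_div_odd_pow {s : ℕ} (hs : 1 < s) :
    HasSum (fun n : ℕ => 1 / (2 * (n : ℝ) + 1) ^ s)
      ((1 - 1 / 2 ^ s) * ∑' n : ℕ, 1 / (n : ℝ) ^ s) := by
  have hsum : Summable fun n : ℕ => 1 / (n : ℝ) ^ s := Real.summable_one_div_nat_pow.mpr hs
  have hodd : Summable fun n : ℕ => 1 / (2 * (n : ℝ) + 1) ^ s := by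
    have := hsum.comp_injective (i := fun n : ℕ => 2 * n + 1) (fun a b h => by simpa using h)
    simpa [Function.comp_def] using this
  have heven : HasSum (fun n : ℕ => 1 / ((2 * n : ℕ) : ℝ) ^ s)
      (1 / 2 ^ s * ∑' n : ℕ, 1 / (n : ℝ) ^ s) := by
    refine (hsum.hasSum.mul_left (1 / 2 ^ s : ℝ)).congr_fun fun n => ?_
    push_cast
    rw [mul_pow, one_div_mul_one_div]
  have hodd' : HasSum (fun n : ℕ => 1 / ((2 * n + 1 : ℕ) : ℝ) ^ s)
      (∑' n : ℕ, 1 / (2 * (n : ℝ) + 1) ^ s) := by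
    simpa using hodd.hasSum
  have h := (heven.even_add_odd (f := fun n : ℕ => 1 / (n : ℝ) ^ s) hodd').tsum_eq
  have : (1 - 1 / 2 ^ s) * ∑' n : ℕ, 1 / (n : ℝ) ^ s = ∑' n : ℕ, 1 / (2 * (n : ℝ) + 1) ^ s := by
    linear_combination h
  exact this ▸ hodd.hasSum

theorem hasDerivAt_pi_mul_cot_pi_mul {w : ℂ} (hw : Complex.sin (π * w) ≠ 0) :
    HasDerivAt (fun x : ℂ => π * Complex.cot (π * x)) (-(π / Complex.sin (π * w)) ^ 2) w := by
  have hlin : HasDerivAt (fun x : ℂ => (π : ℂ) * x) π w := by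
    simpa using (hasDerivAt_id w).const_mul (π : ℂ)
  have h := ((hlin.ccos).div hlin.csin hw).const_mul (π : ℂ)
  refine h.congr_deriv ?_
  have := Complex.sin_sq_add_cos_sq (π * w)
  field_simp
  linear_combination -this

theorem hasSum_int_one_div_add_sq {w : ℂ} (hw : 0 < w.im) :
    HasSum (fun n : ℤ => 1 / (w + n) ^ 2) ((π / Complex.sin (π * w)) ^ 2) := by
  have hsum : Summable fun n : ℤ => 1 / (w + n) ^ 2 := by
    simpa using EisensteinSeries.linear_right_summable w 1 (k := 2) le_rfl
  have hsin : Complex.sin (π * w) ≠ 0 :=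
    sin_pi_mul_ne_zero (UpperHalfPlane.coe_mem_integerComplement ⟨w, hw⟩)
  have h := iteratedDerivWithin_cot_pi_mul_eq_mul_tsum_div_pow le_rfl
    (show w ∈ UpperHalfPlane.upperHalfPlaneSet from hw)
  rw [iteratedDerivWithin_one,
    derivWithin_of_isOpen UpperHalfPlane.isOpen_upperHalfPlaneSet hw,
    (hasDerivAt_pi_mul_cot_pi_mul hsin).deriv] at h
  have : (π / Complex.sin (π * w)) ^ 2 = ∑' n : ℤ, 1 / (w + n) ^ 2 := by
    norm_num at h ⊢
    exact h
  exact this ▸ hsum.hasSum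

/-- The poles of `tanh` in the upper half plane are the points `I * tanhPole n`. -/
noncomputable def tanhPole (n : ℕ) : ℝ := (2 * n + 1) * π / 2

theorem tanhPole_pos (n : ℕ) : 0 < tanhPole n := by
  unfold tanhPole; positivity

theorem hasSum_one_div_tanhPole_pow {s : ℕ} (hs : 1 < s) :
    HasSum (fun n => 1 / tanhPole n ^ s)
      ((2 / π) ^ s * ((1 - 1 / 2 ^ s) * ∑' n : ℕ, 1 / (n : ℝ) ^ s)) := by
  refine ((hasSum_one_div_odd_pow hs).mul_left ((2 / π) ^ s)).congr_fun fun n => ?_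
  unfold tanhPole
  simp only [div_pow, mul_pow]
  field_simp

theorem hasSum_one_div_cosh_sq {z : ℝ} (hz : 0 < z) :
    HasSum (fun n => 2 * (tanhPole n ^ 2 - z ^ 2) / (z ^ 2 + tanhPole n ^ 2) ^ 2)
      (1 / cosh z ^ 2) := by
  have hπ : (π : ℂ) ≠ 0 := by exact_mod_cast pi_ne_zero
  set w : ℂ := 1 / 2 + Complex.I * (z / π : ℝ) with hw
  have him : 0 < w.im := by simp [hw]; positivity
  have hsin : Complex.sin (π * w) = Complex.cosh z := by
    rw [← Complex.cos_mul_I, ← Complex.sin_add_pi_div_two]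
    congr 1
    rw [hw]
    push_cast
    field_simp
    ring
  have h := ((hasSum_int_one_div_add_sq him).nat_add_neg_add_one).mul_left (1 / (π : ℂ) ^ 2)
  rw [hsin] at h
  rw [← Complex.hasSum_ofReal]
  have hval : ((1 / cosh z ^ 2 : ℝ) : ℂ) = 1 / (π : ℂ) ^ 2 * (π / Complex.cosh z) ^ 2 := by
    push_cast
    field_simp
  rw [hval]
  refine h.congr_fun fun n => ?_
  have h1 : (tanhPole n : ℂ) + Complex.I * z ≠ 0 := fun h => by
    simpa [hz.ne'] using congrArg Complex.im h
  have h2 : -(tanhPole n : ℂ) + Complex.I * z ≠ 0 := fun h => by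
    simpa [hz.ne'] using congrArg Complex.im h
  have e1 : w + ((n : ℤ) : ℂ) = ((tanhPole n : ℂ) + Complex.I * z) / π := by
    rw [hw, tanhPole]; push_cast; field_simp; ring
  have e2 : w + ((-(n + 1 : ℤ) : ℤ) : ℂ) = (-(tanhPole n : ℂ) + Complex.I * z) / π := by
    rw [hw, tanhPole]; push_cast; field_simp; ring
  have e3 : (z : ℂ) ^ 2 + (tanhPole n : ℂ) ^ 2 =
      -(((tanhPole n : ℂ) + Complex.I * z) * (-(tanhPole n : ℂ) + Complex.I * z)) := by
    linear_combination (z : ℂ) ^ 2 * Complex.I_sq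
  have e4 : 2 * ((tanhPole n : ℂ) ^ 2 - (z : ℂ) ^ 2) =
      ((tanhPole n : ℂ) + Complex.I * z) ^ 2 + (-(tanhPole n : ℂ) + Complex.I * z) ^ 2 := by
    linear_combination (-2 * (z : ℂ) ^ 2) * Complex.I_sq
  rw [e1, e2]
  push_cast
  rw [e3, e4]
  generalize (tanhPole n : ℂ) + Complex.I * z = u at h1 ⊢
  generalize -(tanhPole n : ℂ) + Complex.I * z = v at h2 ⊢
  field_simp
  ring

/-- Mittag-Leffler expansion of `(tanh z / z) ^ 2`, with nonnegative terms. -/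
theorem hasSum_tanh_sq_div_sq {z : ℝ} (hz : 0 < z) :
    HasSum (fun n => 2 / tanhPole n ^ 2 *
      ((z ^ 2 + 3 * tanhPole n ^ 2) / (z ^ 2 + tanhPole n ^ 2) ^ 2))
      (tanh z ^ 2 / z ^ 2) := by
  have h1 := (hasSum_one_div_tanhPole_pow one_lt_two).mul_left 2
  rw [hasSum_zeta_two.tsum_eq] at h1
  have hval : tanh z ^ 2 / z ^ 2 =
      (2 * ((2 / π) ^ 2 * ((1 - 1 / 2 ^ 2) * (π ^ 2 / 6))) - 1 / cosh z ^ 2) / z ^ 2 := by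
    have hc := cosh_pos z
    rw [tanh_eq_sinh_div_cosh, div_pow, sinh_sq]
    field_simp
    ring
  rw [hval]
  refine ((h1.sub (hasSum_one_div_cosh_sq hz)).div_const (z ^ 2)).congr_fun fun n => ?_
  have ha := tanhPole_pos n
  field_simp
  ring

theorem integrableOn_and_integral_rational {a : ℝ} (ha : 0 < a) :
    IntegrableOn (fun z : ℝ => (z ^ 2 + 3 * a ^ 2) / (z ^ 2 + a ^ 2) ^ 2) (Set.Ioi 0) ∧
      ∫ z in Set.Ioi (0 : ℝ), (z ^ 2 + 3 * a ^ 2) / (z ^ 2 + a ^ 2) ^ 2 = π / a := by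
  have hderiv : ∀ z ∈ Set.Ici (0 : ℝ), HasDerivAt
      (fun z : ℝ => 2 / a * arctan (z / a) + z / (z ^ 2 + a ^ 2))
      ((z ^ 2 + 3 * a ^ 2) / (z ^ 2 + a ^ 2) ^ 2) z := by
    intro z _
    have h1 := (((hasDerivAt_id z).div_const a).arctan).const_mul (2 / a)
    have h2 := (hasDerivAt_id z).div (((hasDerivAt_id z).pow 2).add_const (a ^ 2))
      (by simp only [id, Pi.pow_apply]; positivity)
    refine (h1.add h2).congr_deriv ?_
    simp only [id, Pi.pow_apply]
    have : a ^ 2 + z ^ 2 ≠ 0 := by positivity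
    field_simp
    ring
  have hlim : Tendsto (fun z : ℝ => 2 / a * arctan (z / a) + z / (z ^ 2 + a ^ 2)) atTop
      (𝓝 (π / a)) := by
    have h1 : Tendsto (fun z : ℝ => 2 / a * arctan (z / a)) atTop (𝓝 (2 / a * (π / 2))) :=
      ((tendsto_arctan_atTop.mono_right nhdsWithin_le_nhds).comp
        (tendsto_id.atTop_div_const ha)).const_mul _
    have h2 : Tendsto (fun z : ℝ => z / (z ^ 2 + a ^ 2)) atTop (𝓝 0) := by
      refine squeeze_zero' ?_ ?_ tendsto_inv_atTop_zero
      · filter_upwards [eventually_gt_atTop 0] with z hz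
        positivity
      · filter_upwards [eventually_gt_atTop 0] with z hz
        rw [div_le_iff₀ (by positivity)]
        field_simp
        nlinarith [sq_nonneg a]
    convert h1.add h2 using 2
    field_simp
    ring
  have hpos : ∀ z ∈ Set.Ioi (0 : ℝ), 0 ≤ (z ^ 2 + 3 * a ^ 2) / (z ^ 2 + a ^ 2) ^ 2 :=
    fun z _ => by positivity
  refine ⟨integrableOn_Ioi_deriv_of_nonneg' hderiv hpos hlim, ?_⟩
  rw [integral_Ioi_of_hasDerivAt_of_nonneg' hderiv hpos hlim]
  simp

theorem integral_tanh_sq_div_sq :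
    ∫ z in Set.Ioi (0 : ℝ), tanh z ^ 2 / z ^ 2 =
      14 * (∑' n : ℕ, 1 / (n : ℝ) ^ 3) / π ^ 2 := by
  set F : ℕ → ℝ → ℝ := fun n z => 2 / tanhPole n ^ 2 *
      ((z ^ 2 + 3 * tanhPole n ^ 2) / (z ^ 2 + tanhPole n ^ 2) ^ 2) with hF
  have hint (n : ℕ) : ∫ z in Set.Ioi (0 : ℝ), F n z = 2 * π * (1 / tanhPole n ^ 3) := by
    have ha := tanhPole_pos n
    simp only [hF]
    rw [integral_const_mul, (integrableOn_and_integral_rational ha).2]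
    field_simp
  have hnorm (n : ℕ) : ∫ z in Set.Ioi (0 : ℝ), ‖F n z‖ = 2 * π * (1 / tanhPole n ^ 3) := by
    rw [← hint]
    refine integral_congr_ae (ae_of_all _ fun z => norm_of_nonneg ?_)
    simp only [hF]
    positivity
  have hsum := (hasSum_one_div_tanhPole_pow (s := 3) (by norm_num)).mul_left (2 * π)
  have h := hasSum_integral_of_summable_integral_norm (F := F)
    (μ := volume.restrict (Set.Ioi 0))
    (fun n => (integrableOn_and_integral_rational (tanhPole_pos n)).1.const_mul _)
    (by simpa only [hnorm] using hsum.summable)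
  simp only [hint] at h
  rw [setIntegral_congr_fun measurableSet_Ioi
    (fun z hz => (hasSum_tanh_sq_div_sq hz).tsum_eq.symm), h.unique hsum]
  field_simp
  ring

theorem stmt_0 :
    (↑(∫ z in Set.Ioi (0:ℝ), Real.tanh z ^ 2 / z ^ 2) : ℂ) = 14 * riemannZeta 3 / (π:ℂ) ^ 2 := by
  have h := zeta_nat_eq_tsum_of_gt_one (k := 3) (by norm_num)
  push_cast at h
  rw [h, integral_tanh_sq_div_sq]
  push_cast
  rfl
end

section
/- ∫₀^∞ tanh(z)⁶/z² dz = 322 ζ(3)/(15π²) - 248 ζ(5)/π⁴ + 762 ζ(7)/π⁶. -/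
open Real MeasureTheory

open Filter Topology

/-- The partial-fraction kernel `Im ((a + i z)⁻ᵖ) / z`. -/
noncomputable def poleKernel (p : ℕ) (a z : ℝ) : ℝ :=
  (((a : ℂ) + z * Complex.I) ^ p)⁻¹.im / z

lemma add_mul_I_ne_zero {a : ℝ} (ha : 0 < a) (z : ℝ) : (a : ℂ) + z * Complex.I ≠ 0 := by
  intro h
  have := congrArg Complex.re h
  simp at this
  exact ha.ne' this

lemma normSq_ofReal_add_mul_I (a z : ℝ) :
    Complex.normSq ((a : ℂ) + z * Complex.I) = a ^ 2 + z ^ 2 := by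
  simp [Complex.normSq_apply]; ring

lemma poleKernel_one {a z : ℝ} (hz : 0 < z) :
    poleKernel 1 a z = -(a ^ 2 + z ^ 2)⁻¹ := by
  rw [poleKernel, pow_one, Complex.inv_im, normSq_ofReal_add_mul_I]
  simp
  field_simp

lemma poleKernel_succ {a : ℝ} (ha : 0 < a) {z : ℝ} (hz : 0 < z) (p : ℕ) :
    poleKernel (p + 1) a z =
      a⁻¹ * (poleKernel p a z - (((a : ℂ) + z * Complex.I) ^ (p + 1))⁻¹.re) := by
  have hx := add_mul_I_ne_zero ha z
  have h : (((a : ℂ) + z * Complex.I) ^ p)⁻¹ =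
      ((a : ℂ) + z * Complex.I) * (((a : ℂ) + z * Complex.I) ^ (p + 1))⁻¹ := by
    rw [pow_succ]; field_simp
  rw [poleKernel, poleKernel, h]
  simp only [Complex.mul_im, Complex.add_re, Complex.ofReal_re, Complex.mul_re, Complex.I_re,
    Complex.ofReal_im, Complex.I_im, Complex.add_im]
  field_simp
  ring

lemma hasDerivAt_inv_pow_im {a : ℝ} (ha : 0 < a) (p : ℕ) (z : ℝ) :
    HasDerivAt (fun y : ℝ => (((a : ℂ) + y * Complex.I) ^ p)⁻¹.im)
      (-(p * (((a : ℂ) + z * Complex.I) ^ (p + 1))⁻¹.re)) z := by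
  have hx := add_mul_I_ne_zero ha z
  have h1 : HasDerivAt (fun y : ℝ => (a : ℂ) + y * Complex.I) Complex.I z := by
    simpa using ((Complex.ofRealCLM.hasDerivAt (x := z)).mul_const Complex.I).const_add (a : ℂ)
  have h2 := (h1.pow p).inv (pow_ne_zero p hx)
  have h3 := Complex.imCLM.hasFDerivAt.comp_hasDerivAt z h2
  convert! h3 using 1
  have : -((p : ℂ) * ((a : ℂ) + z * Complex.I) ^ (p - 1) * Complex.I) /
      (((a : ℂ) + z * Complex.I) ^ p) ^ 2 =
      ((-p : ℝ) : ℂ) * ((((a : ℂ) + z * Complex.I) ^ (p + 1))⁻¹ * Complex.I) := by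
    rcases p with _ | p
    · simp
    · push_cast
      field_simp
      ring
  simp only [Pi.pow_apply, Complex.imCLM_apply]
  rw [this, Complex.im_ofReal_mul]
  simp

lemma tendsto_inv_pow_im {a : ℝ} (p : ℕ) (hp : p ≠ 0) :
    Tendsto (fun y : ℝ => (((a : ℂ) + y * Complex.I) ^ p)⁻¹.im) atTop (𝓝 0) := by
  have h1 : Tendsto (fun y : ℝ => (a : ℂ) + y * Complex.I) atTop (Bornology.cobounded ℂ) := by
    rw [← tendsto_norm_atTop_iff_cobounded]
    refine tendsto_atTop_mono (fun y => ?_) tendsto_id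
    refine (le_abs_self _).trans ?_
    simpa using Complex.abs_im_le_norm ((a : ℂ) + y * Complex.I)
  have h2 := (tendsto_inv₀_cobounded.comp h1).pow p
  rw [zero_pow hp] at h2
  simpa [Function.comp_def, ← inv_pow] using (Complex.continuous_im.tendsto _).comp h2

lemma exists_poleKernel_antideriv {a : ℝ} (ha : 0 < a) (q : ℕ) :
    ∃ G : ℝ → ℝ, G 0 = 0 ∧ Continuous G ∧
      (∀ z, 0 < z → HasDerivAt G (poleKernel (q + 1) a z) z) ∧
      Tendsto G atTop (𝓝 (-(π / 2) / a ^ (q + 1))) := by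
  induction q with
  | zero =>
    refine ⟨fun z => -arctan (z / a) / a, by simp, by fun_prop, fun z hz => ?_, ?_⟩
    · rw [zero_add, poleKernel_one hz]
      have := ((((hasDerivAt_id z).div_const a).arctan).neg).div_const a
      convert! this using 1
      simp
      field_simp
    · have := ((tendsto_nhds_of_tendsto_nhdsWithin tendsto_arctan_atTop).comp
        (tendsto_id.atTop_div_const ha)).neg.div_const a
      simpa using this
  | succ q ih =>
    obtain ⟨G, h0, hc, hd, hl⟩ := ih
    have hd' := hasDerivAt_inv_pow_im ha (q + 1)
    refine ⟨fun z => a⁻¹ * (G z + (q + 1 : ℝ)⁻¹ *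
      (((a : ℂ) + z * Complex.I) ^ (q + 1))⁻¹.im), ?_, ?_, fun z hz => ?_, ?_⟩
    · simp [h0, ← Complex.ofReal_pow, ← Complex.ofReal_inv]
    · have : Continuous (fun y : ℝ => (((a : ℂ) + y * Complex.I) ^ (q + 1))⁻¹.im) :=
        continuous_iff_continuousAt.2 fun z => (hd' z).continuousAt
      fun_prop
    · convert! ((hd z hz).add ((hd' z).const_mul (q + 1 : ℝ)⁻¹)).const_mul a⁻¹ using 1
      rw [poleKernel_succ ha hz]
      push_cast
      field_simp
      ring
    · convert! (hl.add ((tendsto_inv_pow_im (a := a) (q + 1) (by simp)).const_mul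
        (q + 1 : ℝ)⁻¹)).const_mul a⁻¹ using 2
      field_simp
      ring

lemma abs_im_pow_le (x : ℂ) (q : ℕ) : |(x ^ (q + 1)).im| ≤ (q + 1) * |x.im| * ‖x‖ ^ q := by
  induction q with
  | zero => simp
  | succ q ih =>
    rw [pow_succ, Complex.mul_im]
    calc |(x ^ (q + 1)).re * x.im + (x ^ (q + 1)).im * x.re|
        ≤ |(x ^ (q + 1)).re| * |x.im| + |(x ^ (q + 1)).im| * |x.re| := by
          rw [← abs_mul, ← abs_mul]; exact abs_add_le _ _
      _ ≤ ‖x‖ ^ (q + 1) * |x.im| + ((q + 1) * |x.im| * ‖x‖ ^ q) * ‖x‖ := by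
          gcongr
          · simpa using Complex.abs_re_le_norm (x ^ (q + 1))
          · exact Complex.abs_re_le_norm x
      _ = _ := by push_cast; ring

lemma abs_poleKernel_le {a : ℝ} (ha : 0 < a) {z : ℝ} (hz : 0 < z) (q : ℕ) :
    |poleKernel (q + 1) a z| ≤ (q + 1) / a ^ q * (a ^ 2 + z ^ 2)⁻¹ := by
  set x : ℂ := (a : ℂ) + z * Complex.I with hx
  have hx0 : x ≠ 0 := add_mul_I_ne_zero ha z
  have hn : ‖x‖ ^ 2 = a ^ 2 + z ^ 2 := by
    rw [← Complex.normSq_eq_norm_sq, hx, normSq_ofReal_add_mul_I]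
  have hxp : 0 < ‖x‖ := norm_pos_iff.2 hx0
  have hax : a ≤ ‖x‖ := by
    have := Complex.abs_re_le_norm x
    simp [hx] at this
    exact (le_abs_self a).trans this
  have him : x.im = z := by simp [hx]
  have h := abs_im_pow_le x q
  rw [him, abs_of_pos hz] at h
  rw [poleKernel, ← hx, Complex.inv_im, Complex.normSq_eq_norm_sq, abs_div, abs_div, abs_neg,
    abs_of_pos hz, norm_pow, abs_of_pos (by positivity : 0 < (‖x‖ ^ (q + 1)) ^ 2), ← hn]
  calc |(x ^ (q + 1)).im| / (‖x‖ ^ (q + 1)) ^ 2 / z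
      ≤ ((q + 1) * z * ‖x‖ ^ q) / (‖x‖ ^ (q + 1)) ^ 2 / z := by gcongr
    _ = (q + 1) / ‖x‖ ^ q * (‖x‖ ^ 2)⁻¹ := by field_simp; ring
    _ ≤ _ := by gcongr

lemma measurable_poleKernel (p : ℕ) (a : ℝ) : Measurable (poleKernel p a) := by
  unfold poleKernel
  fun_prop

lemma integrableOn_inv_sq_add_sq {a : ℝ} (ha : 0 < a) :
    IntegrableOn (fun z : ℝ => (a ^ 2 + z ^ 2)⁻¹) (Set.Ioi 0) := by
  obtain ⟨G, -, hc, hd, hl⟩ := exists_poleKernel_antideriv ha 0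
  have h := integrableOn_Ioi_deriv_of_nonpos (a := 0) hc.continuousWithinAt hd
    (fun z hz => by
      rw [zero_add, poleKernel_one hz]
      exact neg_nonpos.2 (by positivity)) hl
  refine h.neg.congr_fun (fun z hz => ?_) measurableSet_Ioi
  simp [poleKernel_one (Set.mem_Ioi.1 hz)]

lemma integrableOn_poleKernel {a : ℝ} (ha : 0 < a) (q : ℕ) :
    IntegrableOn (poleKernel (q + 1) a) (Set.Ioi 0) := by
  refine Integrable.mono' ((integrableOn_inv_sq_add_sq ha).const_mul ((q + 1) / a ^ q))
    (measurable_poleKernel _ _).aestronglyMeasurable ?_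
  exact (ae_restrict_mem measurableSet_Ioi).mono fun z hz => abs_poleKernel_le ha hz q

lemma integral_poleKernel {a : ℝ} (ha : 0 < a) (q : ℕ) :
    ∫ z in Set.Ioi 0, poleKernel (q + 1) a z = -(π / 2) / a ^ (q + 1) := by
  obtain ⟨G, h0, hc, hd, hl⟩ := exists_poleKernel_antideriv ha q
  rw [integral_Ioi_of_hasDerivAt_of_tendsto hc.continuousWithinAt hd
    (integrableOn_poleKernel ha q) hl, h0, sub_zero]

lemma integral_Ioi_inv_sq_add_sq {a : ℝ} (ha : 0 < a) :
    ∫ z in Set.Ioi 0, (a ^ 2 + z ^ 2)⁻¹ = π / 2 / a := by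
  have h := integral_poleKernel ha 0
  rw [setIntegral_congr_fun measurableSet_Ioi
    (g := fun z => -(a ^ 2 + z ^ 2)⁻¹) (fun z hz => by simpa using poleKernel_one hz),
    integral_neg] at h
  simp only [zero_add, pow_one] at h
  linear_combination -h

lemma integral_norm_poleKernel_le {a : ℝ} (ha : 0 < a) (q : ℕ) :
    ∫ z in Set.Ioi 0, ‖poleKernel (q + 1) a z‖ ≤ (q + 1) * (π / 2) * (1 / a ^ (q + 1)) := by
  calc ∫ z in Set.Ioi 0, ‖poleKernel (q + 1) a z‖
      ≤ ∫ z in Set.Ioi 0, (q + 1) / a ^ q * (a ^ 2 + z ^ 2)⁻¹ :=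
        setIntegral_mono_on (integrableOn_poleKernel ha q).norm
          ((integrableOn_inv_sq_add_sq ha).const_mul _) measurableSet_Ioi
          fun z hz => abs_poleKernel_le ha hz q
    _ = _ := by
        rw [integral_const_mul, integral_Ioi_inv_sq_add_sq ha]
        field_simp
        ring

lemma hasSum_one_div_add_half_pow {p : ℕ} (hp : 1 < p) :
    HasSum (fun n : ℕ => 1 / ((n : ℂ) + 1 / 2) ^ p) ((2 ^ p - 1) * riemannZeta p) := by
  have hs : Summable fun n : ℕ => 1 / (n : ℂ) ^ p :=
    .of_norm (by simpa using Real.summable_one_div_nat_pow.2 hp)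
  have hz : HasSum (fun n : ℕ => 1 / (n : ℂ) ^ p) (riemannZeta p) := by
    rw [zeta_nat_eq_tsum_of_gt_one hp]
    exact hs.hasSum
  have he : HasSum (fun n : ℕ => 1 / ((2 * n : ℕ) : ℂ) ^ p) (1 / 2 ^ p * riemannZeta p) := by
    convert! hz.mul_left (1 / 2 ^ p : ℂ) using 2 with n
    push_cast
    rw [mul_pow]
    field_simp
  have ho : Summable fun n : ℕ => 1 / ((2 * n + 1 : ℕ) : ℂ) ^ p :=
    hs.comp_injective (i := fun n : ℕ => 2 * n + 1) fun m n h => by simpa using h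
  have h := hz.unique (HasSum.even_add_odd he ho.hasSum)
  have h2 : ∑' n : ℕ, 1 / ((2 * n + 1 : ℕ) : ℂ) ^ p = (1 - 1 / 2 ^ p) * riemannZeta p := by
    linear_combination -h
  have h3 := (h2 ▸ ho.hasSum).mul_left (2 ^ p : ℂ)
  convert! h3 using 1
  · ext n
    rw [show ((2 * n + 1 : ℕ) : ℂ) = 2 * ((n : ℂ) + 1 / 2) by push_cast; ring, mul_pow]
    field_simp
  · field_simp

lemma summable_one_div_half_odd_pi_pow {p : ℕ} (hp : 1 < p) :
    Summable (fun n : ℕ => 1 / (((n : ℝ) + 1 / 2) * π) ^ p) := by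
  have h := (hasSum_one_div_add_half_pow hp).summable.norm.mul_right (1 / π ^ p)
  refine h.congr fun n => ?_
  rw [← Complex.ofReal_natCast, show (1 / 2 : ℂ) = ((1 / 2 : ℝ) : ℂ) by simp,
    ← Complex.ofReal_add, norm_div, norm_pow, Complex.norm_real, norm_one, mul_pow,
    Real.norm_of_nonneg (by positivity)]
  field_simp

lemma ofReal_tsum_one_div_half_odd_pi_pow {p : ℕ} (hp : 1 < p) :
    ((∑' n : ℕ, 1 / (((n : ℝ) + 1 / 2) * π) ^ p : ℝ) : ℂ) =
      (2 ^ p - 1) * riemannZeta p / π ^ p := by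
  rw [Complex.ofReal_tsum]
  refine (((hasSum_one_div_add_half_pow hp).div_const ((π : ℂ) ^ p)).congr_fun fun n => ?_).tsum_eq
  push_cast
  rw [mul_pow]
  field_simp

lemma integral_tsum_poleKernel {q : ℕ} (hq : 1 ≤ q) :
    ∫ z in Set.Ioi 0, ∑' n : ℕ, poleKernel (q + 1) ((n + 1 / 2) * π) z =
      -(π / 2) * ∑' n : ℕ, 1 / (((n : ℝ) + 1 / 2) * π) ^ (q + 1) := by
  have ha : ∀ n : ℕ, 0 < ((n : ℝ) + 1 / 2) * π := fun n => by positivity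
  have hs := summable_one_div_half_odd_pi_pow (p := q + 1) (by lia)
  have h := hasSum_integral_of_summable_integral_norm (μ := volume.restrict (Set.Ioi 0))
    (F := fun (n : ℕ) z => poleKernel (q + 1) ((n + 1 / 2) * π) z)
    (fun n => integrableOn_poleKernel (ha n) q)
    (Summable.of_nonneg_of_le (fun n => integral_nonneg fun z => norm_nonneg _)
      (fun n => integral_norm_poleKernel_le (ha n) q) (hs.mul_left _))
  rw [← h.tsum_eq, ← tsum_mul_left]
  refine tsum_congr fun n => ?_
  rw [integral_poleKernel (ha n)]
  ring

/-- The polynomials expressing the iterated derivatives of a solution of `f' = -(c + f²)`. -/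
noncomputable def riccatiPoly (c : ℂ) (k : ℕ) : Polynomial ℂ :=
  (fun P => -(P.derivative * (Polynomial.C c + Polynomial.X ^ 2)))^[k] Polynomial.X

lemma riccatiPoly_succ (c : ℂ) (k : ℕ) :
    riccatiPoly c (k + 1) =
      -((riccatiPoly c k).derivative * (Polynomial.C c + Polynomial.X ^ 2)) :=
  Function.iterate_succ_apply' _ _ _

lemma iteratedDerivWithin_eq_eval_riccatiPoly {f : ℂ → ℂ} {s : Set ℂ} (hs : IsOpen s) {c : ℂ}
    (hf : ∀ z ∈ s, HasDerivAt f (-(c + f z ^ 2)) z) (k : ℕ) :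
    ∀ z ∈ s, iteratedDerivWithin k f s z = (riccatiPoly c k).eval (f z) := by
  induction k with
  | zero => simp [riccatiPoly]
  | succ k ih =>
    intro z hz
    rw [iteratedDerivWithin_succ, derivWithin_congr ih (ih z hz),
      derivWithin_of_isOpen hs hz, riccatiPoly_succ]
    refine (((riccatiPoly c k).hasDerivAt (f z)).comp z (hf z hz)).deriv.trans ?_
    simp only [Polynomial.eval_neg, Polynomial.eval_mul, Polynomial.eval_add, Polynomial.eval_C,
      Polynomial.eval_pow, Polynomial.eval_X]
    ring

lemma hasDerivAt_pi_mul_cot {z : ℂ} (hz : 0 < z.im) :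
    HasDerivAt (fun x : ℂ => π * Complex.cot (π * x))
      (-((π : ℂ) ^ 2 + (π * Complex.cot (π * z)) ^ 2)) z := by
  have hsin : Complex.sin (π * z) ≠ 0 := by
    intro h
    obtain ⟨k, hk⟩ := Complex.sin_eq_zero_iff.1 h
    exact hz.ne' (by simpa [Real.pi_ne_zero] using congrArg Complex.im hk)
  have h1 : HasDerivAt (fun x : ℂ => (π : ℂ) * x) π z := by
    simpa using (hasDerivAt_id z).const_mul (π : ℂ)
  have h2 := (((Complex.hasDerivAt_cos _).comp z h1).div
    ((Complex.hasDerivAt_sin _).comp z h1) hsin).const_mul (π : ℂ)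
  convert! h2 using 1
  simp only [Complex.cot_eq_cos_div_sin, Function.comp]
  field_simp
  ring

lemma eval_riccatiPoly_cot {k : ℕ} (hk : 1 ≤ k) {w : ℂ} (hw : 0 < w.im) :
    (riccatiPoly ((π : ℂ) ^ 2) k).eval (π * Complex.cot (π * w)) =
      (-1) ^ k * k.factorial * ∑' n : ℤ, 1 / (w + n) ^ (k + 1) := by
  rw [← iteratedDerivWithin_cot_pi_mul_eq_mul_tsum_div_pow hk hw]
  exact (iteratedDerivWithin_eq_eval_riccatiPoly UpperHalfPlane.isOpen_upperHalfPlaneSet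
    (f := fun x : ℂ => π * Complex.cot (π * x))
    (fun z hz => hasDerivAt_pi_mul_cot hz) k w hw).symm

lemma cot_half_add_mul_I (z : ℝ) :
    Complex.cot (π * (1 / 2 + z / π * Complex.I)) = -Complex.I * (Real.tanh z : ℝ) := by
  have hpi : (π : ℂ) ≠ 0 := by exact_mod_cast Real.pi_ne_zero
  rw [show (π : ℂ) * (1 / 2 + z / π * Complex.I) = z * Complex.I + π / 2 by field_simp; ring,
    Complex.cot_eq_cos_div_sin, Complex.cos_add_pi_div_two, Complex.sin_add_pi_div_two,
    Complex.sin_mul_I, Complex.cos_mul_I, Complex.ofReal_tanh, Complex.tanh_eq_sinh_div_cosh]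
  ring

lemma tsum_int_inv_pow_eq {k : ℕ} (hk : 1 ≤ k) (hev : Even k) (z : ℝ) :
    ∑' n : ℤ, 1 / ((1 / 2 + z / π * Complex.I : ℂ) + n) ^ (k + 1) =
      2 * Complex.I * π ^ (k + 1) *
        (∑' n : ℕ, ((((n + 1 / 2) * π : ℝ) + z * Complex.I : ℂ) ^ (k + 1))⁻¹.im : ℝ) := by
  have hpi : (π : ℂ) ≠ 0 := by exact_mod_cast Real.pi_ne_zero
  have hs : Summable fun n : ℤ => 1 / ((1 / 2 + z / π * Complex.I : ℂ) + n) ^ (k + 1) := by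
    have := EisensteinSeries.linear_right_summable (1 / 2 + z / π * Complex.I : ℂ) 1
      (k := k + 1) (by lia)
    refine this.congr fun n => ?_
    rw [Int.cast_one, one_mul, ← one_div]
    norm_cast
  rw [← tsum_nat_add_neg_add_one hs, Complex.ofReal_tsum, ← tsum_mul_left]
  refine tsum_congr fun n => ?_
  set x : ℂ := (((n + 1 / 2) * π : ℝ) + z * Complex.I : ℂ) with hx
  have h1 : (1 / 2 + z / π * Complex.I : ℂ) + (n : ℤ) = x / π := by
    rw [hx]; push_cast; field_simp; ring
  have h2 : (1 / 2 + z / π * Complex.I : ℂ) + (-(n + 1) : ℤ) = -(starRingEnd ℂ x) / π := by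
    rw [hx]
    simp only [map_add, map_mul, Complex.conj_ofReal, Complex.conj_I]
    push_cast; field_simp; ring
  have h3 := Complex.sub_conj (x ^ (k + 1))⁻¹
  rw [map_inv₀, map_pow] at h3
  rw [h1, h2, div_pow, div_pow, hev.add_one.neg_pow, one_div_div, one_div_div, div_neg]
  push_cast at h3
  linear_combination (π : ℂ) ^ (k + 1) * h3

lemma riccatiPoly_eval_tanh {k : ℕ} (hk : 1 ≤ k) (hev : Even k) {z : ℝ} (hz : 0 < z) :
    (riccatiPoly ((π : ℂ) ^ 2) k).eval (-(π * Complex.I * (Real.tanh z : ℝ))) =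
      2 * k.factorial * Complex.I * π ^ (k + 1) *
        ((z * ∑' n : ℕ, poleKernel (k + 1) ((n + 1 / 2) * π) z : ℝ) : ℂ) := by
  have hw : 0 < (1 / 2 + z / π * Complex.I : ℂ).im := by
    rw [← Complex.ofReal_div]
    simp
    positivity
  have h := eval_riccatiPoly_cot hk hw
  have hS : z * ∑' n : ℕ, poleKernel (k + 1) ((n + 1 / 2) * π) z =
      ∑' n : ℕ, ((((n + 1 / 2) * π : ℝ) + z * Complex.I : ℂ) ^ (k + 1))⁻¹.im := by
    simp only [poleKernel]
    rw [tsum_div_const, mul_div_cancel₀ _ hz.ne']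
  rw [tsum_int_inv_pow_eq hk hev, cot_half_add_mul_I, hev.neg_one_pow, ← hS] at h
  rw [show -(π * Complex.I * (Real.tanh z : ℝ)) = π * (-Complex.I * (Real.tanh z : ℝ)) by ring, h]
  ring

section

open Polynomial

lemma riccatiPoly_two (c : ℂ) : riccatiPoly c 2 = C (2 * c) * X + C 2 * X ^ 3 := by
  have h1 : riccatiPoly c 1 = -(C c + X ^ 2) := by
    rw [riccatiPoly_succ, riccatiPoly]
    simp
  rw [riccatiPoly_succ, h1]
  simp only [derivative_neg, derivative_add, derivative_C, derivative_X_pow, map_mul]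
  norm_num
  ring

lemma riccatiPoly_four (c : ℂ) :
    riccatiPoly c 4 = C (16 * c ^ 2) * X + C (40 * c) * X ^ 3 + C 24 * X ^ 5 := by
  have h3 : riccatiPoly c 3 = -(C (2 * c ^ 2) + C (8 * c) * X ^ 2 + C 6 * X ^ 4) := by
    rw [riccatiPoly_succ, riccatiPoly_two]
    simp only [derivative_add, derivative_C_mul, derivative_X, derivative_X_pow]
    simp only [map_mul, map_pow, map_ofNat, Nat.cast_ofNat]
    norm_num
    ring
  rw [riccatiPoly_succ, h3]
  simp only [derivative_neg, derivative_add, derivative_C, derivative_C_mul, derivative_X_pow]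
  simp only [map_mul, map_pow, map_ofNat, Nat.cast_ofNat]
  norm_num
  ring

lemma riccatiPoly_six (c : ℂ) :
    riccatiPoly c 6 = C (272 * c ^ 3) * X + C (1232 * c ^ 2) * X ^ 3 + C (1680 * c) * X ^ 5 +
      C 720 * X ^ 7 := by
  have h5 : riccatiPoly c 5 =
      -(C (16 * c ^ 3) + C (136 * c ^ 2) * X ^ 2 + C (240 * c) * X ^ 4 + C 120 * X ^ 6) := by
    rw [riccatiPoly_succ, riccatiPoly_four]
    simp only [derivative_add, derivative_C_mul, derivative_X, derivative_X_pow]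
    simp only [map_mul, map_pow, map_ofNat, Nat.cast_ofNat]
    norm_num
    ring
  rw [riccatiPoly_succ, h5]
  simp only [derivative_neg, derivative_add, derivative_C, derivative_C_mul, derivative_X_pow]
  simp only [map_mul, map_pow, map_ofNat, Nat.cast_ofNat]
  norm_num
  ring

lemma eval_riccatiPoly_two (c x : ℂ) :
    (riccatiPoly c 2).eval x = x * (2 * (c + x ^ 2)) := by
  simp only [riccatiPoly_two, eval_add, eval_mul, eval_C, eval_X, eval_pow]
  ring

lemma eval_riccatiPoly_four (c x : ℂ) :
    (riccatiPoly c 4).eval x = x * ((16 * c + 24 * x ^ 2) * (c + x ^ 2)) := by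
  simp only [riccatiPoly_four, eval_add, eval_mul, eval_C, eval_X, eval_pow]
  ring

lemma eval_riccatiPoly_six (c x : ℂ) :
    (riccatiPoly c 6).eval x =
      x * ((272 * c ^ 2 + 960 * c * x ^ 2 + 720 * (x ^ 2) ^ 2) * (c + x ^ 2)) := by
  simp only [riccatiPoly_six, eval_add, eval_mul, eval_C, eval_X, eval_pow]
  ring

end

lemma neg_pi_mul_I_mul_sq (t : ℝ) : (-(π * Complex.I * t)) ^ 2 = -((π : ℂ) ^ 2 * t ^ 2) := by
  linear_combination (π : ℂ) ^ 2 * t ^ 2 * Complex.I_sq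

lemma tsum_poleKernel_three {z : ℝ} (hz : 0 < z) :
    ∑' n : ℕ, poleKernel 3 ((n + 1 / 2) * π) z =
      -(1 / 2) * (tanh z * (1 - tanh z ^ 2) / z) := by
  have h := riccatiPoly_eval_tanh (k := 2) (by lia) (by decide) hz
  rw [eval_riccatiPoly_two, neg_pi_mul_I_mul_sq] at h
  have h0 : 4 * (π : ℂ) ^ 3 * Complex.I ≠ 0 := by simp [Real.pi_ne_zero]
  rw [mul_div_assoc', eq_div_iff hz.ne', mul_comm]
  apply Complex.ofReal_injective
  apply mul_left_cancel₀ h0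
  norm_num [Nat.factorial] at h ⊢
  linear_combination -h

lemma tsum_poleKernel_five {z : ℝ} (hz : 0 < z) :
    ∑' n : ℕ, poleKernel 5 ((n + 1 / 2) * π) z =
      -(1 / 6) * (2 - 3 * tanh z ^ 2) * (tanh z * (1 - tanh z ^ 2) / z) := by
  have h := riccatiPoly_eval_tanh (k := 4) (by lia) (by decide) hz
  rw [eval_riccatiPoly_four, neg_pi_mul_I_mul_sq] at h
  have h0 : 48 * (π : ℂ) ^ 5 * Complex.I ≠ 0 := by simp [Real.pi_ne_zero]
  rw [mul_div_assoc', eq_div_iff hz.ne', mul_comm]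
  apply Complex.ofReal_injective
  apply mul_left_cancel₀ h0
  norm_num [Nat.factorial] at h ⊢
  linear_combination -h

lemma tsum_poleKernel_seven {z : ℝ} (hz : 0 < z) :
    ∑' n : ℕ, poleKernel 7 ((n + 1 / 2) * π) z =
      -(1 / 90) * (17 - 60 * tanh z ^ 2 + 45 * tanh z ^ 4) *
        (tanh z * (1 - tanh z ^ 2) / z) := by
  have h := riccatiPoly_eval_tanh (k := 6) (by lia) (by decide) hz
  rw [eval_riccatiPoly_six, neg_pi_mul_I_mul_sq] at h
  have h0 : 1440 * (π : ℂ) ^ 7 * Complex.I ≠ 0 := by simp [Real.pi_ne_zero]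
  rw [mul_div_assoc', eq_div_iff hz.ne', mul_comm]
  apply Complex.ofReal_injective
  apply mul_left_cancel₀ h0
  norm_num [Nat.factorial] at h ⊢
  linear_combination -h

lemma hasDerivAt_tanh (z : ℝ) : HasDerivAt tanh (1 - tanh z ^ 2) z := by
  have hc := (cosh_pos z).ne'
  have h := (hasDerivAt_sinh z).div (hasDerivAt_cosh z) hc
  rw [show tanh = sinh / cosh from funext tanh_eq_sinh_div_cosh]
  convert! h using 1
  simp only [Pi.div_apply]
  field_simp

lemma continuous_tanh : Continuous tanh :=
  continuous_iff_continuousAt.2 fun z => (hasDerivAt_tanh z).continuousAt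

lemma tanh_nonneg {z : ℝ} (hz : 0 ≤ z) : 0 ≤ tanh z := by
  rw [tanh_eq_sinh_div_cosh]
  exact div_nonneg (sinh_nonneg_iff.2 hz) (cosh_pos z).le

lemma one_sub_tanh_sq_le {z : ℝ} (hz : 0 ≤ z) : 1 - tanh z ^ 2 ≤ (1 + z ^ 2)⁻¹ := by
  have h : z ^ 2 ≤ sinh z ^ 2 :=
    pow_le_pow_left₀ hz (self_le_sinh_iff.2 hz) 2
  have hc : 1 - tanh z ^ 2 = (1 + sinh z ^ 2)⁻¹ := by
    rw [tanh_eq_sinh_div_cosh, ← cosh_sq', div_pow, cosh_sq']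
    field_simp
    ring
  rw [hc]
  gcongr

lemma tanh_le_self {z : ℝ} (hz : 0 ≤ z) : tanh z ≤ z := by
  have h : MonotoneOn (fun x => x - tanh x) (Set.Ici 0) :=
    monotoneOn_of_hasDerivWithinAt_nonneg (f' := fun x => tanh x ^ 2) (convex_Ici 0)
      (continuous_id.sub continuous_tanh).continuousOn
      (fun x _ => by
        convert! ((hasDerivAt_id x).sub (hasDerivAt_tanh x)).hasDerivWithinAt using 1
        ring)
      (fun x _ => sq_nonneg _)
  simpa using h (Set.mem_Ici.2 le_rfl) hz hz

lemma integrableOn_tanh_mul_sech_sq_div :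
    IntegrableOn (fun z => tanh z * (1 - tanh z ^ 2) / z) (Set.Ioi 0) := by
  have hm : Measurable tanh := continuous_tanh.measurable
  refine Integrable.mono' integrable_inv_one_add_sq.integrableOn
    (by fun_prop : Measurable _).aestronglyMeasurable ?_
  refine (ae_restrict_mem measurableSet_Ioi).mono fun z hz => ?_
  have hz : 0 < z := hz
  have h1 := tanh_nonneg hz.le
  have h2 := tanh_sq_lt_one z
  rw [norm_of_nonneg (div_nonneg (mul_nonneg h1 (by linarith)) hz.le), mul_div_right_comm]
  calc tanh z / z * (1 - tanh z ^ 2) ≤ 1 * (1 - tanh z ^ 2) :=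
        mul_le_mul_of_nonneg_right (div_le_one_of_le₀ (tanh_le_self hz.le) hz.le) (by linarith)
    _ ≤ _ := by simpa using one_sub_tanh_sq_le hz.le

lemma integrableOn_mul_tanh_mul_sech_sq_div {f : ℝ → ℝ} (hf : Continuous f) :
    IntegrableOn (fun z => f (tanh z) * (tanh z * (1 - tanh z ^ 2) / z)) (Set.Ioi 0) := by
  obtain ⟨C, hC⟩ := (isCompact_Icc (a := (-1 : ℝ)) (b := 1)).exists_bound_of_continuousOn
    hf.continuousOn
  exact integrableOn_tanh_mul_sech_sq_div.bdd_mul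
    (hf.comp continuous_tanh).aestronglyMeasurable
    (.of_forall fun z => hC _ ⟨(neg_one_lt_tanh z).le, (tanh_lt_one z).le⟩)

lemma integrableOn_tanh_pow_six_div_sq :
    IntegrableOn (fun z => tanh z ^ 6 / z ^ 2) (Set.Ioi 0) := by
  have hm : Measurable tanh := continuous_tanh.measurable
  refine Integrable.mono' (integrable_inv_one_add_sq.integrableOn.const_mul 2)
    (by fun_prop : Measurable _).aestronglyMeasurable ?_
  refine (ae_restrict_mem measurableSet_Ioi).mono fun z hz => ?_
  have hz : 0 < z := hz
  have h1 := tanh_nonneg hz.le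
  have h2 := tanh_sq_lt_one z
  have h3 : tanh z ^ 2 ≤ z ^ 2 := by
    gcongr
    exact tanh_le_self hz.le
  have h4 : tanh z ^ 6 ≤ tanh z ^ 2 := pow_le_pow_of_le_one h1 (tanh_lt_one z).le (by lia)
  rw [norm_of_nonneg (by positivity), div_le_iff₀ (by positivity), ← div_eq_mul_inv,
    div_mul_eq_mul_div, le_div_iff₀ (by positivity)]
  nlinarith [sq_nonneg z]

lemma integral_tanh_pow_six_div_sq_eq :
    ∫ z in Set.Ioi (0 : ℝ), tanh z ^ 6 / z ^ 2 =
      ∫ z in Set.Ioi (0 : ℝ), 6 * tanh z ^ 4 * (tanh z * (1 - tanh z ^ 2) / z) := by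
  have hI := integrableOn_mul_tanh_mul_sech_sq_div (f := fun t => 6 * t ^ 4) (by fun_prop)
  have hd : ∀ z ∈ Set.Ioi (0 : ℝ), HasDerivAt (fun z => tanh z ^ 6 / z)
      (6 * tanh z ^ 4 * (tanh z * (1 - tanh z ^ 2) / z) - tanh z ^ 6 / z ^ 2) z := by
    intro z hz
    have hz0 : z ≠ 0 := (Set.mem_Ioi.1 hz).ne'
    convert! ((hasDerivAt_tanh z).pow 6).div (hasDerivAt_id z) hz0 using 1
    simp
    field_simp
  have hc : ContinuousWithinAt (fun z => tanh z ^ 6 / z) (Set.Ici 0) 0 := by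
    have h : Tendsto (fun z : ℝ => z ^ 5) (𝓝[Set.Ici 0] 0) (𝓝 0) := by
      have : Continuous fun z : ℝ => z ^ 5 := by fun_prop
      simpa using (this.tendsto 0).mono_left nhdsWithin_le_nhds
    rw [ContinuousWithinAt, div_zero]
    refine squeeze_zero' ?_ ?_ h
    · filter_upwards [self_mem_nhdsWithin] with z hz
      have hz : 0 ≤ z := hz
      positivity
    · filter_upwards [self_mem_nhdsWithin] with z hz
      have hz : 0 ≤ z := hz
      refine div_le_of_le_mul₀ hz (by positivity) ?_
      calc tanh z ^ 6 ≤ z ^ 6 := pow_le_pow_left₀ (tanh_nonneg hz) (tanh_le_self hz) 6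
        _ = z ^ 5 * z := by ring
  have ht : Tendsto (fun z => tanh z ^ 6 / z) atTop (𝓝 0) := by
    refine squeeze_zero' ?_ ?_ tendsto_inv_atTop_zero
    · filter_upwards [eventually_gt_atTop 0] with z hz
      positivity
    · filter_upwards [eventually_gt_atTop 0] with z hz
      rw [← one_div]
      gcongr
      exact pow_le_one₀ (tanh_nonneg hz.le) (tanh_lt_one z).le
  have h := integral_Ioi_of_hasDerivAt_of_tendsto hc hd
    (hI.sub integrableOn_tanh_pow_six_div_sq) ht
  rw [integral_sub hI integrableOn_tanh_pow_six_div_sq] at h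
  simp only [div_zero, sub_zero] at h
  linarith

lemma integral_tanh_pow_six_div_sq_eq_tsum :
    ∫ z in Set.Ioi (0 : ℝ), tanh z ^ 6 / z ^ 2 =
      π / 2 * (92 / 15 * ∑' n : ℕ, 1 / (((n : ℝ) + 1 / 2) * π) ^ 3 -
        16 * ∑' n : ℕ, 1 / (((n : ℝ) + 1 / 2) * π) ^ 5 +
        12 * ∑' n : ℕ, 1 / (((n : ℝ) + 1 / 2) * π) ^ 7) := by
  have h3 := integral_tsum_poleKernel (q := 2) (by lia)
  have h5 := integral_tsum_poleKernel (q := 4) (by lia)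
  have h7 := integral_tsum_poleKernel (q := 6) (by lia)
  rw [setIntegral_congr_fun measurableSet_Ioi fun z hz => tsum_poleKernel_three hz] at h3
  rw [setIntegral_congr_fun measurableSet_Ioi fun z hz => tsum_poleKernel_five hz] at h5
  rw [setIntegral_congr_fun measurableSet_Ioi fun z hz => tsum_poleKernel_seven hz] at h7
  have i3 := integrableOn_mul_tanh_mul_sech_sq_div (f := fun _ => -(1 / 2)) (by fun_prop)
  have i5 := integrableOn_mul_tanh_mul_sech_sq_div
    (f := fun t => -(1 / 6) * (2 - 3 * t ^ 2)) (by fun_prop)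
  have i7 := integrableOn_mul_tanh_mul_sech_sq_div
    (f := fun t => -(1 / 90) * (17 - 60 * t ^ 2 + 45 * t ^ 4)) (by fun_prop)
  have h := integral_add ((i3.const_mul (-(92 / 15))).add (i5.const_mul 16)) (i7.const_mul (-12))
  simp only [Pi.add_apply] at h
  rw [integral_add (i3.const_mul (-(92 / 15))) (i5.const_mul 16),
    integral_const_mul (-(92 / 15) : ℝ), integral_const_mul (16 : ℝ),
    integral_const_mul (-12 : ℝ), h3, h5, h7] at h
  rw [integral_tanh_pow_six_div_sq_eq]
  refine Eq.trans (integral_congr_ae (.of_forall fun z => ?_)) (h.trans ?_)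
  · ring
  · ring

theorem stmt_6 :
    (↑(∫ z in Set.Ioi (0:ℝ), Real.tanh z ^ 6 / z ^ 2) : ℂ) = 322 * riemannZeta 3 / (15 * (π:ℂ) ^ 2) - 248 * riemannZeta 5 / (π:ℂ) ^ 4 + 762 * riemannZeta 7 / (π:ℂ) ^ 6 := by
  have h3 := ofReal_tsum_one_div_half_odd_pi_pow (p := 3) (by lia)
  have h5 := ofReal_tsum_one_div_half_odd_pi_pow (p := 5) (by lia)
  have h7 := ofReal_tsum_one_div_half_odd_pi_pow (p := 7) (by lia)
  have hpi : (π : ℂ) ≠ 0 := by exact_mod_cast Real.pi_ne_zero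
  rw [integral_tanh_pow_six_div_sq_eq_tsum, Complex.ofReal_mul, Complex.ofReal_add,
    Complex.ofReal_sub, Complex.ofReal_mul, Complex.ofReal_mul, Complex.ofReal_mul, h3, h5, h7]
  push_cast
  field_simp
  ring
end
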